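/- arXiv:2004.08604 — 5 statements merged into one kernel-verified Lean document; each statement's English description precedes it below -/
import Mathlib

section
/- Let α be a real number with 0 < α < 1, let γ = (1+α)/(1-α), and let α′ = 2α/(1+α²). Then 0 < α′ < 1 and (1+α′)/(1-α′) = γ²; equivalently, α′ = (γ²-1)/(γ²+1). In other words, one uniform collapse step transforms an α-accurate sketch (with base γ) into an α′-accurate sketch (with base γ² ) where α′ = 2α/(1+α²). -/
/-- One uniform collapse step: if `0 < α < 1`, `γ = (1+α)/(1-α)` and
`α' = 2α/(1+α²)`, then `0 < α' < 1`, `(1+α')/(1-α') = γ²` and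
`α' = (γ²-1)/(γ²+1)`. -/
theorem uniform_collapse_accuracy (α γ α' : ℝ) (hα₀ : 0 < α) (hα₁ : α < 1)
    (hγ : γ = (1 + α) / (1 - α)) (hα' : α' = 2 * α / (1 + α ^ 2)) :
    (0 < α' ∧ α' < 1) ∧ (1 + α') / (1 - α') = γ ^ 2 ∧
      α' = (γ ^ 2 - 1) / (γ ^ 2 + 1) := by
  have h_sub : 0 < 1 - α := sub_pos.mpr hα₁
  have h_sq : 0 < 1 + α ^ 2 := by positivity
  have h_lt : α' < 1 := by
    rw [hα', div_lt_one h_sq]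
    nlinarith [pow_pos h_sub 2]
  have h_mul : α' * (1 + α ^ 2) = 2 * α := by
    rw [hα', div_mul_cancel₀ _ h_sq.ne']
  have h_base : γ ^ 2 * (1 - α) ^ 2 = (1 + α) ^ 2 := by
    rw [hγ, div_pow, div_mul_cancel₀ _ (pow_pos h_sub 2).ne']
  have h_collapse : 1 + α' = γ ^ 2 * (1 - α') := by
    apply mul_right_cancel₀ h_sq.ne'
    linear_combination (1 + γ ^ 2) * h_mul - h_base
  refine ⟨⟨by rw [hα']; positivity, h_lt⟩, ?_, ?_⟩
  · rw [div_eq_iff (sub_pos.mpr h_lt).ne', h_collapse]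
  · rw [eq_div_iff (by positivity)]
    linear_combination h_collapse
end

section
/- Let γ > 1 be a real number and x > 0 a real number. If i = ⌈log_γ x⌉ is the index of the bucket containing x before a uniform collapse, then the index of the bucket containing x after the collapse is j = ⌈log_{γ²} x⌉ = ⌈i/2⌉. That is, ⌈log_{γ²} x⌉ = ⌈⌈log_γ x⌉ / 2⌉. -/
theorem ceil_div_natCast_eq_ceil_ceil_div (y : ℝ) {n : ℕ} (hn : 0 < n) :
    ⌈y / n⌉ = ⌈(⌈y⌉ : ℚ) / n⌉ := by
  refine eq_of_forall_ge_iff fun z => ?_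
  have hR : (0 : ℝ) < n := by exact_mod_cast hn
  have hQ : (0 : ℚ) < n := by exact_mod_cast hn
  rw [Int.ceil_le, Int.ceil_le, div_le_iff₀ hR, div_le_iff₀ hQ]
  have h : y ≤ ((z * n : ℤ) : ℝ) ↔ ((⌈y⌉ : ℤ) : ℚ) ≤ ((z * n : ℤ) : ℚ) := by
    rw [← Int.ceil_le, Int.cast_le]
  simpa only [Int.cast_mul, Int.cast_natCast] using h

theorem logb_pow_base (b x : ℝ) (n : ℕ) : Real.logb (b ^ n) x = Real.logb b x / n := by
  rw [Real.logb, Real.logb, Real.log_pow, div_div, mul_comm]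

/-- Bucket index after a uniform collapse: for `γ > 1` and `x > 0`,
`⌈log_{γ²} x⌉ = ⌈⌈log_γ x⌉ / 2⌉`. -/
theorem uniform_collapse_bucket_index (γ x : ℝ) (hγ : 1 < γ) (hx : 0 < x) :
    ⌈Real.logb (γ ^ 2) x⌉ = ⌈(⌈Real.logb γ x⌉ : ℚ) / 2⌉ := by
  rw [logb_pow_base]
  exact ceil_div_natCast_eq_ceil_ceil_div (Real.logb γ x) two_pos
end

section
/- Let γ > 1 and γ̃ > 1 be real numbers and k a natural number. If γ^{2^k} < γ̃, then γ^{2^{k+1}} < γ̃². Consequently, the accuracy parameter associated with the base γ^{2^{k+1}} is strictly smaller than (γ̃²-1)/(γ̃²+1): (γ^{2^{k+1}} - 1)/(γ^{2^{k+1}} + 1) < (γ̃² - 1)/(γ̃² + 1). -/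
/-- If `γ, γ̃ > 1` and `γ^{2^k} < γ̃`, then `γ^{2^{k+1}} < γ̃²` and hence the
accuracy parameter of the base `γ^{2^{k+1}}` is below `(γ̃²-1)/(γ̃²+1)`. -/
theorem collapse_base_accuracy_bound (γ γ' : ℝ) (hγ : 1 < γ) (hγ' : 1 < γ')
    (k : ℕ) (h : γ ^ 2 ^ k < γ') :
    γ ^ 2 ^ (k + 1) < γ' ^ 2 ∧
      (γ ^ 2 ^ (k + 1) - 1) / (γ ^ 2 ^ (k + 1) + 1) <
        (γ' ^ 2 - 1) / (γ' ^ 2 + 1) := by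
  have hsq : γ ^ 2 ^ (k + 1) < γ' ^ 2 := by
    rw [pow_succ, pow_mul]
    gcongr
  refine ⟨hsq, ?_⟩
  have hpos : 0 < γ ^ 2 ^ (k + 1) := by positivity
  rw [div_lt_div_iff₀ (by positivity) (by positivity)]
  linarith
end

section
/- Let α₀ ∈ (0,1) and define α_{k+1} = 2α_k/(1+α_k²) for k ≥ 0, and let γ_k = (1+α_k)/(1-α_k) be the corresponding bucket bases. Then for every natural number k, γ_k = γ₀^{2^k}; that is, k uniform collapses raise the initial base γ₀ to the power 2^k. -/
/-- A uniform collapse squares the bucket base. At `a = 1` both sides are `0`, by the convention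
for division by zero. -/
lemma base_collapse (a : ℝ) :
    (1 + 2 * a / (1 + a ^ 2)) / (1 - 2 * a / (1 + a ^ 2)) = ((1 + a) / (1 - a)) ^ 2 := by
  have hd : 1 + a ^ 2 ≠ 0 := by positivity
  have hnum : 1 + 2 * a / (1 + a ^ 2) = (1 + a) ^ 2 / (1 + a ^ 2) := by
    field_simp
    ring
  have hden : 1 - 2 * a / (1 + a ^ 2) = (1 - a) ^ 2 / (1 + a ^ 2) := by
    field_simp
    ring
  rw [hnum, hden, div_div_div_cancel_right₀ hd, div_pow]

/-- `k` uniform collapses raise the initial base to the power `2^k`: with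
`α₀ ∈ (0,1)`, `α_{k+1} = 2α_k/(1+α_k²)` and `γ_k = (1+α_k)/(1-α_k)`, one has
`γ_k = γ₀^{2^k}` for every `k`. -/
theorem base_after_k_collapses (α γ : ℕ → ℝ)
    (h₀ : α 0 ∈ Set.Ioo (0 : ℝ) 1)
    (hrec : ∀ k, α (k + 1) = 2 * α k / (1 + α k ^ 2))
    (hγ : ∀ k, γ k = (1 + α k) / (1 - α k)) :
    ∀ k, γ k = γ 0 ^ 2 ^ k := by
  intro k
  induction k with
  | zero => simp
  | succ k ih => rw [hγ (k + 1), hrec, base_collapse, ← hγ, ih, pow_succ 2 k, pow_mul]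
end

section
/- Let f : ℤ → ℕ be a finitely supported function (the bucket counts of a sketch) and define g : ℤ → ℕ by g(j) = f(2j−1) + f(2j) (the bucket counts after a uniform collapse). Then g is finitely supported, the total counts agree, ∑_j g(j) = ∑_i f(i), and moreover for every integer j the partial sums agree: ∑_{i ≤ 2j} f(i) = ∑_{i' ≤ j} g(i'). -/
theorem Int.injective_two_mul_sub_one : Function.Injective fun j : ℤ => 2 * j - 1 :=
  fun a b h => by dsimp only at h; omega

theorem Int.injective_two_mul : Function.Injective fun j : ℤ => 2 * j :=
  fun a b h => by dsimp only at h; omega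

/-- A finitely supported sum over `ℤ` can be computed by pairing the indices `2j-1` and `2j`. -/
theorem finsum_two_mul_sub_one_add_two_mul {M : Type*} [AddCommMonoid M] (f : ℤ → M)
    (hf : (Function.support f).Finite) :
    ∑ᶠ j : ℤ, (f (2 * j - 1) + f (2 * j)) = ∑ᶠ i, f i := by
  have hdisj : Disjoint (Set.range fun j : ℤ => 2 * j - 1) (Set.range fun j : ℤ => 2 * j) := by
    rw [Set.disjoint_left]
    rintro _ ⟨a, rfl⟩ ⟨b, hb⟩
    dsimp only at hb
    omega
  have hunion :
      (Set.range fun j : ℤ => 2 * j - 1) ∪ (Set.range fun j : ℤ => 2 * j) = Set.univ := by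
    refine Set.eq_univ_of_forall fun i => ?_
    rcases Int.even_or_odd' i with ⟨k, rfl | rfl⟩
    · exact Or.inr ⟨k, rfl⟩
    · exact Or.inl ⟨k + 1, by ring⟩
  rw [finsum_add_distrib (hf.preimage Int.injective_two_mul_sub_one.injOn)
      (hf.preimage Int.injective_two_mul.injOn),
    ← finsum_mem_range (f := f) Int.injective_two_mul_sub_one,
    ← finsum_mem_range (f := f) Int.injective_two_mul,
    ← finsum_mem_union' hdisj (hf.inter_of_right _) (hf.inter_of_right _), hunion,
    finsum_mem_univ]

/-- Uniform collapse of bucket counts: if `f : ℤ → ℕ` has finite support and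
`g j = f (2j-1) + f (2j)`, then `g` has finite support, the total counts agree,
and for every `j` the partial sums agree: `∑_{i ≤ 2j} f i = ∑_{i' ≤ j} g i'`. -/
theorem uniform_collapse_counts (f g : ℤ → ℕ)
    (hf : (Function.support f).Finite)
    (hg : ∀ j, g j = f (2 * j - 1) + f (2 * j)) :
    (Function.support g).Finite ∧
      (∑ᶠ j, g j) = (∑ᶠ i, f i) ∧
      ∀ j : ℤ, (∑ᶠ i ∈ {i : ℤ | i ≤ 2 * j}, f i) = ∑ᶠ i' ∈ {i' : ℤ | i' ≤ j}, g i' := by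
  obtain rfl : g = fun j => f (2 * j - 1) + f (2 * j) := funext hg
  refine ⟨?_, finsum_two_mul_sub_one_add_two_mul f hf, fun j => ?_⟩
  · exact ((hf.preimage Int.injective_two_mul_sub_one.injOn).union
      (hf.preimage Int.injective_two_mul.injOn)).subset (Function.support_add _ _)
  · rw [finsum_mem_def, finsum_mem_def,
      ← finsum_two_mul_sub_one_add_two_mul _
        (hf.subset (Set.support_indicator.trans_subset Set.inter_subset_right))]
    refine finsum_congr fun k => ?_
    by_cases hk : k ≤ j
    · have h : 2 * k - 1 ≤ 2 * j := by omega
      simp [Set.indicator, hk, h]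
    · have h : ¬ 2 * k - 1 ≤ 2 * j := by omega
      simp [Set.indicator, hk, h]
end
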